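/- Consider the generalized integral action-based dynamics ẋ(t) = −αL(G)x(t) + L(G)ξ(t) − α(K₁x(t) − K₂c), ξ̇(t) = −γL(G)x(t), with gains α > 0 and γ > 0, where G is a connected undirected simple graph on n vertices, K₂ is a nonzero 0–1 matrix, K₁ = diag with k₁,ᵢ = Σⱼ k₂,ᵢⱼ, and c ∈ ℝⁿ is constant. Then for every differentiable solution (x, ξ) defined on [0, ∞), x(t) converges as t → ∞ to ε·1ₙ, where ε = (1ₙᵀK₂c)/(1ₙᵀK₂1ₙ). -/

import Mathlib

open Matrix Filter

section Calculus

theorem HasDerivAt.dotProduct_fun {m : Type*} [Fintype m] {f g : ℝ → m → ℝ} {f' g' : m → ℝ}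
    {t : ℝ} (hf : HasDerivAt f f' t) (hg : HasDerivAt g g' t) :
    HasDerivAt (fun s => f s ⬝ᵥ g s) (f' ⬝ᵥ g t + f t ⬝ᵥ g') t := by
  have h := HasDerivAt.fun_sum (u := Finset.univ) fun i _ =>
    (hasDerivAt_pi.1 hf i).fun_mul (hasDerivAt_pi.1 hg i)
  simpa only [dotProduct, Finset.sum_add_distrib] using h

theorem HasDerivAt.const_mulVec_fun {m : Type*} [Fintype m] (A : Matrix m m ℝ)
    {f : ℝ → m → ℝ} {f' : m → ℝ} {t : ℝ} (hf : HasDerivAt f f' t) :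
    HasDerivAt (fun s => A *ᵥ f s) (A *ᵥ f') t :=
  (LinearMap.toContinuousLinearMap A.mulVecLin).hasFDerivAt.comp_hasDerivAt t hf

theorem antitoneOn_Ici_of_hasDerivAt_nonpos {f f' : ℝ → ℝ} {a : ℝ}
    (hf : ∀ t, a ≤ t → HasDerivAt f (f' t) t) (hf' : ∀ t, a ≤ t → f' t ≤ 0) :
    AntitoneOn f (Set.Ici a) := by
  refine antitoneOn_of_hasDerivWithinAt_nonpos (f' := f') (convex_Ici a)
    (fun t ht => (hf t ht).continuousAt.continuousWithinAt)
    (fun t ht => (hf t (interior_subset ht)).hasDerivWithinAt)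
    fun t ht => hf' t (interior_subset ht)

theorem AntitoneOn.exists_tendsto_atTop_of_nonneg {f : ℝ → ℝ} {a : ℝ}
    (hf : AntitoneOn f (Set.Ici a)) (h0 : ∀ t, a ≤ t → 0 ≤ f t) :
    ∃ l, Tendsto f atTop (nhds l) := by
  have hanti : Antitone fun t => f (max a t) := fun s t hst =>
    hf (le_max_left a s) (le_max_left a t) (max_le_max_left a hst)
  have hbdd : BddBelow (Set.range fun t => f (max a t)) :=
    ⟨0, by rintro _ ⟨t, rfl⟩; exact h0 _ (le_max_left a t)⟩
  refine ⟨_, (tendsto_atTop_ciInf hanti hbdd).congr' ?_⟩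
  filter_upwards [eventually_ge_atTop a] with t ht
  rw [max_eq_right ht]

/-- A Barbalat-type lemma: if a nonnegative function `V` dissipates at the rate `a * u` with
`u` nonnegative of derivative bounded above, then `u` tends to zero. -/
theorem tendsto_zero_of_dissipation {V u u' : ℝ → ℝ} {a C : ℝ} (ha : 0 < a) (hC : 0 ≤ C)
    (hV : ∀ t, 0 ≤ t → HasDerivAt V (-(a * u t)) t)
    (hu : ∀ t, 0 ≤ t → HasDerivAt u (u' t) t)
    (hV0 : ∀ t, 0 ≤ t → 0 ≤ V t) (hu0 : ∀ t, 0 ≤ t → 0 ≤ u t)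
    (hu' : ∀ t, 0 ≤ t → u' t ≤ C) :
    Tendsto u atTop (nhds 0) := by
  have hV' : ∀ t, 0 ≤ t → -(a * u t) ≤ 0 := fun t ht =>
    neg_nonpos.2 (mul_nonneg ha.le (hu0 t ht))
  obtain ⟨l, hl⟩ := (antitoneOn_Ici_of_hasDerivAt_nonpos hV hV').exists_tendsto_atTop_of_nonneg hV0
  obtain ⟨k, hk⟩ : ∃ k, Tendsto (fun t => u t ^ 2 + 2 * C / a * V t) atTop (nhds k) := by
    refine AntitoneOn.exists_tendsto_atTop_of_nonneg (a := 0)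
      (antitoneOn_Ici_of_hasDerivAt_nonpos (f' := fun t => 2 * u t * (u' t - C))
        (fun t ht => ?_) fun t ht => ?_) fun t ht => ?_
    · convert! ((hu t ht).fun_pow 2).fun_add ((hV t ht).const_mul (2 * C / a)) using 1
      field_simp
      ring
    · exact mul_nonpos_of_nonneg_of_nonpos (by linarith [hu0 t ht]) (by linarith [hu' t ht])
    · have := hV0 t ht
      positivity
  have hsq : Tendsto (fun t => u t ^ 2) atTop (nhds (k - 2 * C / a * l)) := by
    simpa using hk.sub (hl.const_mul (2 * C / a))
  have hlim : Tendsto u atTop (nhds (√(k - 2 * C / a * l))) := by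
    refine hsq.sqrt.congr' ?_
    filter_upwards [eventually_ge_atTop 0] with t ht
    exact Real.sqrt_sq (hu0 t ht)
  have hint := MeasureTheory.integrableOn_Ioi_deriv_of_nonpos' hV (fun t ht => hV' t ht.out.le) hl
  have hzero : -(a * √(k - 2 * C / a * l)) = 0 := by
    refine MeasureTheory.IntegrableAtFilter.eq_zero_of_tendsto (μ := MeasureTheory.volume)
      ⟨Set.Ioi 0, Ioi_mem_atTop 0, hint⟩ (fun s hs => ?_) (hlim.const_mul a).neg
    obtain ⟨b, hb⟩ := mem_atTop_sets.1 hs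
    rw [← top_le_iff, ← Real.volume_Ici (a := b)]
    exact MeasureTheory.measure_mono hb
  have hsqrt : √(k - 2 * C / a * l) = 0 := by simpa [ha.ne'] using hzero
  rwa [hsqrt] at hlim

theorem norm_le_sqrt_of_mul_dotProduct_self_le {m : Type*} [Fintype m] {v : m → ℝ} {c R : ℝ}
    (hc : 0 < c) (h : c * (v ⬝ᵥ v) ≤ R) : ‖v‖ ≤ √(R / c) := by
  refine (pi_norm_le_iff_of_nonneg (Real.sqrt_nonneg _)).2 fun i => Real.abs_le_sqrt ?_
  rw [le_div_iff₀' hc]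
  refine le_trans (mul_le_mul_of_nonneg_left ?_ hc.le) h
  rw [sq]
  exact Finset.single_le_sum (f := fun i => v i * v i) (fun j _ => mul_self_nonneg _)
    (Finset.mem_univ i)

/-- Along the skew-coupled system `ẏ = -αMy + Lζ`, `ζ̇ = -γLy` with `L` symmetric and `M` positive
semidefinite, the dissipated energy `yᵀMy` tends to zero. -/
theorem tendsto_dotProduct_mulVec_of_skew_coupled {m : Type*} [Fintype m]
    {L M : Matrix m m ℝ} (hL : L.IsSymm) (hM : ∀ v, 0 ≤ v ⬝ᵥ (M *ᵥ v))
    {α γ : ℝ} (hα : 0 < α) (hγ : 0 < γ) {y ζ : ℝ → m → ℝ}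
    (hy : ∀ t, 0 ≤ t → HasDerivAt y (-(α • (M *ᵥ y t)) + L *ᵥ ζ t) t)
    (hζ : ∀ t, 0 ≤ t → HasDerivAt ζ (-(γ • (L *ᵥ y t))) t) :
    Tendsto (fun t => y t ⬝ᵥ (M *ᵥ y t)) atTop (nhds 0) := by
  set V : ℝ → ℝ := fun t => γ * (y t ⬝ᵥ y t) + ζ t ⬝ᵥ ζ t
  have hself (v : m → ℝ) : 0 ≤ v ⬝ᵥ v := Finset.sum_nonneg fun i _ => mul_self_nonneg (v i)
  have hVderiv : ∀ t, 0 ≤ t → HasDerivAt V (-(2 * α * γ * (y t ⬝ᵥ (M *ᵥ y t)))) t := by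
    intro t ht
    convert! (((hy t ht).dotProduct_fun (hy t ht)).const_mul γ).fun_add
      ((hζ t ht).dotProduct_fun (hζ t ht)) using 1
    have hsymm : ζ t ⬝ᵥ (L *ᵥ y t) = y t ⬝ᵥ (L *ᵥ ζ t) := by
      rw [dotProduct_mulVec, ← mulVec_transpose, hL.eq, dotProduct_comm]
    simp only [add_dotProduct, dotProduct_add, neg_dotProduct, dotProduct_neg, smul_dotProduct,
      dotProduct_smul, smul_eq_mul, dotProduct_comm (M *ᵥ y t) (y t),
      dotProduct_comm (L *ᵥ ζ t) (y t), dotProduct_comm (L *ᵥ y t) (ζ t), hsymm]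
    ring
  have hVle : ∀ t, 0 ≤ t → V t ≤ V 0 := fun t ht =>
    antitoneOn_Ici_of_hasDerivAt_nonpos hVderiv
      (fun s _ => neg_nonpos.2 (mul_nonneg (by positivity) (hM _))) Set.self_mem_Ici ht ht
  let F : (m → ℝ) × (m → ℝ) → ℝ := fun p =>
    (-(α • (M *ᵥ p.1)) + L *ᵥ p.2) ⬝ᵥ (M *ᵥ p.1) +
      p.1 ⬝ᵥ (M *ᵥ (-(α • (M *ᵥ p.1)) + L *ᵥ p.2))
  have hF : Continuous F := by fun_prop
  obtain ⟨C, hC⟩ := ((isCompact_closedBall (0 : m → ℝ) √(V 0 / γ)).prod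
    (isCompact_closedBall (0 : m → ℝ) √(V 0 / 1))).exists_bound_of_continuousOn hF.continuousOn
  refine tendsto_zero_of_dissipation (V := V) (a := 2 * α * γ) (C := |C|)
    (u' := fun t => F (y t, ζ t)) (by positivity) (abs_nonneg C) hVderiv
    (fun t ht => (hy t ht).dotProduct_fun ((hy t ht).const_mulVec_fun M))
    (fun t _ => add_nonneg (mul_nonneg hγ.le (hself _)) (hself _)) (fun t _ => hM _) ?_
  intro t ht
  refine (le_abs_self _).trans ((hC _ ⟨?_, ?_⟩).trans (le_abs_self C)) <;>
    rw [mem_closedBall_zero_iff]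
  · exact norm_le_sqrt_of_mul_dotProduct_self_le hγ
      ((le_add_of_nonneg_right (hself (ζ t))).trans (hVle t ht))
  · refine norm_le_sqrt_of_mul_dotProduct_self_le one_pos ?_
    rw [one_mul]
    exact (le_add_of_nonneg_left (mul_nonneg hγ.le (hself (y t)))).trans (hVle t ht)

end Calculus

namespace SimpleGraph

variable {V : Type*} [Fintype V] [DecidableEq V] {G : SimpleGraph V} [DecidableRel G.Adj]

theorem dotProduct_lapMatrix_mulVec (v : V → ℝ) :
    v ⬝ᵥ (G.lapMatrix ℝ *ᵥ v) = (∑ i, ∑ j, if G.Adj i j then (v i - v j) ^ 2 else 0) / 2 := by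
  rw [← toLinearMap₂'_apply', lapMatrix_toLinearMap₂']

theorem dotProduct_lapMatrix_mulVec_nonneg (v : V → ℝ) : 0 ≤ v ⬝ᵥ (G.lapMatrix ℝ *ᵥ v) := by
  simpa using (posSemidef_lapMatrix ℝ G).dotProduct_mulVec_nonneg v

theorem sq_sub_le_of_adj (v : V → ℝ) {i j : V} (h : G.Adj i j) :
    (v i - v j) ^ 2 / 2 ≤ v ⬝ᵥ (G.lapMatrix ℝ *ᵥ v) := by
  have hnonneg (a b : V) : 0 ≤ if G.Adj a b then (v a - v b) ^ 2 else 0 := by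
    split_ifs <;> positivity
  rw [dotProduct_lapMatrix_mulVec]
  gcongr
  calc (v i - v j) ^ 2 = if G.Adj i j then (v i - v j) ^ 2 else 0 := (if_pos h).symm
    _ ≤ ∑ b, if G.Adj i b then (v i - v b) ^ 2 else 0 :=
      Finset.single_le_sum (f := fun b => if G.Adj i b then (v i - v b) ^ 2 else 0)
        (fun b _ => hnonneg i b) (Finset.mem_univ j)
    _ ≤ _ := Finset.single_le_sum
        (f := fun a => ∑ b, if G.Adj a b then (v a - v b) ^ 2 else 0)
        (fun a _ => Finset.sum_nonneg fun b _ => hnonneg a b) (Finset.mem_univ i)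

/-- On a connected graph, vectors orthogonal to the constants lie in the range of the Laplacian. -/
theorem Connected.exists_lapMatrix_mulVec_eq (hG : G.Connected) {w : V → ℝ} (hw : ∑ i, w i = 0) :
    ∃ v, G.lapMatrix ℝ *ᵥ v = w := by
  have hsymm : (G.lapMatrix ℝ).toEuclideanLin.IsSymmetric :=
    isSymmetric_toEuclideanLin_iff.2 (G.isHermitian_lapMatrix ℝ)
  have hmem : WithLp.toLp 2 w ∈ LinearMap.range (G.lapMatrix ℝ).toEuclideanLin := by
    rw [← Submodule.orthogonal_orthogonal (LinearMap.range _), hsymm.orthogonal_range,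
      Submodule.mem_orthogonal]
    intro z hz
    have hz' : G.lapMatrix ℝ *ᵥ z.ofLp = 0 := congrArg WithLp.ofLp (LinearMap.mem_ker.1 hz)
    rw [lapMatrix_mulVec_eq_zero_iff_forall_reachable] at hz'
    obtain ⟨i₀⟩ := hG.nonempty
    have hconst (i : V) : z.ofLp i = z.ofLp i₀ := hz' i i₀ (hG.preconnected i i₀)
    simp [PiLp.inner_apply, hconst, ← Finset.sum_mul, hw]
  obtain ⟨v, hv⟩ := hmem
  exact ⟨v.ofLp, congrArg WithLp.ofLp hv⟩

theorem dotProduct_diagonal_mulVec_eq_sum (k v : V → ℝ) :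
    v ⬝ᵥ (diagonal k *ᵥ v) = ∑ i, k i * v i ^ 2 := by
  simp only [dotProduct, mulVec_diagonal]
  exact Finset.sum_congr rfl fun i _ => by ring

/-- Convergence to zero of the energy of a grounded Laplacian on a connected graph forces
convergence to zero of the state. -/
theorem Connected.tendsto_zero_of_energy (hG : G.Connected) {k : V → ℝ} (hk : ∀ i, 0 ≤ k i)
    {i₀ : V} (hi₀ : 0 < k i₀) {ι : Type*} {l : Filter ι} {y : ι → V → ℝ}
    (h : Tendsto (fun t => y t ⬝ᵥ ((G.lapMatrix ℝ + diagonal k) *ᵥ y t)) l (nhds 0)) :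
    Tendsto y l (nhds 0) := by
  have hdiag (v : V → ℝ) : ∀ i, 0 ≤ k i * v i ^ 2 := fun i => mul_nonneg (hk i) (sq_nonneg _)
  simp only [add_mulVec, dotProduct_add, dotProduct_diagonal_mulVec_eq_sum] at h
  have tendsto_of_sq {f : ι → ℝ} {c : ℝ} (hc : 0 < c)
      (hf : ∀ t, c * f t ^ 2 ≤ y t ⬝ᵥ (G.lapMatrix ℝ *ᵥ y t) + ∑ i, k i * y t i ^ 2) :
      Tendsto f l (nhds 0) := by
    have hcf : Tendsto (fun t => c⁻¹ * (c * f t ^ 2)) l (nhds (c⁻¹ * 0)) :=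
      (squeeze_zero (fun t => by positivity) hf h).const_mul _
    simp only [inv_mul_cancel_left₀ hc.ne', mul_zero] at hcf
    refine (tendsto_zero_iff_abs_tendsto_zero f).2 ?_
    simpa [Function.comp_def, Real.sqrt_sq_eq_abs] using hcf.sqrt
  have hbase : Tendsto (fun t => y t i₀) l (nhds 0) := tendsto_of_sq hi₀ fun t =>
    (Finset.single_le_sum (f := fun i => k i * y t i ^ 2) (fun i _ => hdiag (y t) i)
      (Finset.mem_univ i₀)).trans (le_add_of_nonneg_left (dotProduct_lapMatrix_mulVec_nonneg _))
  have hadj {i j : V} (hij : G.Adj i j) : Tendsto (fun t => y t i - y t j) l (nhds 0) :=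
    tendsto_of_sq (c := 1 / 2) (by norm_num) fun t => by
      have h₁ := sq_sub_le_of_adj (y t) hij
      have h₂ := Finset.sum_nonneg fun i (_ : i ∈ Finset.univ) => hdiag (y t) i
      linarith
  refine tendsto_pi_nhds.2 fun i => ?_
  obtain ⟨p⟩ := hG.preconnected i i₀
  induction p with
  | nil => exact hbase
  | cons hij _ ih => simpa using (hadj hij).add (ih hi₀ hbase)

end SimpleGraph

/-- Generalized integral action-based dynamics
`ẋ = −αL(G)x + L(G)ξ − α(K₁x − K₂c)`, `ξ̇ = −γL(G)x` with gains `α, γ > 0`: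
the state `x(t)` converges to `ε·1ₙ` with `ε = (1ᵀK₂c)/(1ᵀK₂1)`. -/
theorem active_passive_consensus_generalized {n : ℕ} (G : SimpleGraph (Fin n))
    [DecidableRel G.Adj] (hG : G.Connected)
    (L : Matrix (Fin n) (Fin n) ℝ) (hL : L = G.lapMatrix ℝ)
    (K₂ : Matrix (Fin n) (Fin n) ℝ) (hK₂ : ∀ i j, K₂ i j = 0 ∨ K₂ i j = 1)
    (hK₂ne : K₂ ≠ 0)
    (K₁ : Matrix (Fin n) (Fin n) ℝ)
    (hK₁ : K₁ = Matrix.diagonal fun i => ∑ j, K₂ i j)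
    (ones : Fin n → ℝ) (hones : ones = fun _ => 1)
    (c : Fin n → ℝ) (ε : ℝ) (hε : ε = ones ⬝ᵥ (K₂ *ᵥ c) / (ones ⬝ᵥ (K₂ *ᵥ ones)))
    (α γ : ℝ) (hα : 0 < α) (hγ : 0 < γ)
    (x ξ : ℝ → Fin n → ℝ)
    (hx : ∀ t : ℝ, 0 ≤ t →
      HasDerivAt x (-(α • (L *ᵥ x t)) + L *ᵥ ξ t - α • (K₁ *ᵥ x t - K₂ *ᵥ c)) t)
    (hξ : ∀ t : ℝ, 0 ≤ t → HasDerivAt ξ (-(γ • (L *ᵥ x t))) t) :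
    Tendsto (fun t => x t - ε • ones) atTop (nhds 0) := by
  subst hL hK₁
  set k : Fin n → ℝ := fun i => ∑ j, K₂ i j with hkdef
  have hentry : ∀ i j, 0 ≤ K₂ i j := fun i j => by rcases hK₂ i j with h | h <;> simp [h]
  have hk : ∀ i, 0 ≤ k i := fun i => Finset.sum_nonneg fun j _ => hentry i j
  obtain ⟨i₀, hi₀⟩ : ∃ i, 0 < k i := by
    by_contra! hcon
    refine hK₂ne (Matrix.ext fun i j => ?_)
    exact (Finset.sum_eq_zero_iff_of_nonneg fun j _ => hentry i j).1
      (le_antisymm (hcon i) (hk i)) j (Finset.mem_univ j)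
  have hLones : G.lapMatrix ℝ *ᵥ ones = 0 := hones ▸ G.lapMatrix_mulVec_const_eq_zero
  have hK₂ones : K₂ *ᵥ ones = k := by
    ext i
    simp [mulVec, dotProduct, hones, hkdef]
  have hksum : 0 < ones ⬝ᵥ (K₂ *ᵥ ones) := by
    rw [hK₂ones]
    simpa [dotProduct, hones] using
      Finset.sum_pos' (fun i _ => hk i) ⟨i₀, Finset.mem_univ i₀, hi₀⟩
  obtain ⟨η, hη⟩ := hG.exists_lapMatrix_mulVec_eq (w := α • (ε • k - K₂ *ᵥ c)) (by
    have hdot : ones ⬝ᵥ (α • (ε • k - K₂ *ᵥ c)) = 0 := by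
      rw [dotProduct_smul, dotProduct_sub, dotProduct_smul, ← hK₂ones, hε, smul_eq_mul,
        smul_eq_mul, div_mul_cancel₀ _ hksum.ne', sub_self, mul_zero]
    simpa only [dotProduct, hones, one_mul] using hdot)
  have hdiag : diagonal k *ᵥ ones = k := by
    ext i
    simp [mulVec_diagonal, hones]
  refine hG.tendsto_zero_of_energy hk hi₀ ?_
  refine tendsto_dotProduct_mulVec_of_skew_coupled (ζ := fun t => ξ t - η)
    (G.isSymm_lapMatrix ℝ) (fun v => ?_) hα hγ (fun t ht => ?_) fun t ht => ?_
  · rw [add_mulVec, dotProduct_add, SimpleGraph.dotProduct_diagonal_mulVec_eq_sum]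
    exact add_nonneg (SimpleGraph.dotProduct_lapMatrix_mulVec_nonneg v)
      (Finset.sum_nonneg fun i _ => mul_nonneg (hk i) (sq_nonneg _))
  · convert! (hx t ht).sub_const (ε • ones) using 1
    simp only [add_mulVec, mulVec_sub, mulVec_smul, hLones, hdiag, hη]
    module
  · convert! (hξ t ht).sub_const η using 1
    simp only [mulVec_sub, mulVec_smul, hLones, smul_zero, sub_zero]
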